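/- Assume the composed-BDF setup, with coefficient matrix A' as in system (34) of the paper, and let A'' be the matrix obtained from A' by replacing its last column by the right-hand-side vector (0, −E_0, 0, …, 0)ᵀ. Then det A'' = ((−1)^{p+1} a_1^{p−1} E_0 / γ_0) · (∏_{i=1}^{p−1} ε_i E_i²) · (∏_{1 ≤ i < ℓ ≤ p−1}(E_ℓ − E_i)) · (γ_0 E_0² + a_1² ε_p). (Equation (B3) of the paper, with the exponent p−1 correcting the misprinted a_1^{p+1}.) -/

import Mathlib

open Finset

lemma prod_Icc_one_eq_prod_fin {M : Type*} [CommMonoid M] (f : ℕ → M) (n : ℕ) :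
    ∏ i ∈ Icc 1 n, f i = ∏ i : Fin n, f (i + 1) := by
  induction n with
  | zero => simp
  | succ n ih => simp [Finset.prod_Icc_succ_top, Fin.prod_univ_castSucc, ih]

/-- A Vandermonde-type determinant whose columns are scaled by the squares of the nodes. -/
lemma det_pow_add_two {R : Type*} [CommRing R] {n : ℕ} (x : Fin n → R) :
    (Matrix.of fun i j : Fin n => x j ^ ((i : ℕ) + 2)).det =
      (∏ i, x i ^ 2) * (Matrix.vandermonde x).det := by
  rw [← Matrix.det_transpose (Matrix.vandermonde x), ← Matrix.det_mul_row]
  congr 1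
  ext i j
  simp [Matrix.vandermonde_apply, pow_add, mul_comm]

lemma det_vandermonde_succ_eq {R : Type*} [CommRing R] {n : ℕ} (x : Fin (n + 1) → R) :
    (Matrix.vandermonde x).det =
      (∏ i : Fin n, (x i.succ - x 0)) * (Matrix.vandermonde fun i : Fin n => x i.succ).det := by
  simp only [Matrix.det_vandermonde, Fin.prod_univ_succ, Fin.prod_Ioi_zero, Fin.prod_Ioi_succ]

/-- Adding `K` to the bottom-left entry of the matrix of `det_pow_add_two`. -/
lemma det_pow_add_two_add_corner {R : Type*} [CommRing R] {n : ℕ} (x : Fin (n + 1) → R) (K : R) :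
    (Matrix.of fun i j : Fin (n + 1) =>
        x j ^ ((i : ℕ) + 2) + if i = Fin.last n ∧ j = 0 then K else 0).det =
      (∏ i : Fin n, x i.succ ^ 2) * (Matrix.vandermonde fun i : Fin n => x i.succ).det *
        (x 0 ^ 2 * ∏ i : Fin n, (x i.succ - x 0) + (-1) ^ n * K) := by
  have hminor : (Matrix.of fun i j : Fin n => x j.succ ^ ((i : ℕ) + 2)).det =
      (∏ i : Fin n, x i.succ ^ 2) * (Matrix.vandermonde fun i : Fin n => x i.succ).det :=
    det_pow_add_two _
  have hfull := det_pow_add_two x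
  rw [Matrix.det_succ_column_zero, det_vandermonde_succ_eq, Fin.prod_univ_succ] at hfull
  have hsub (i : Fin (n + 1)) :
      ((Matrix.of fun i j : Fin (n + 1) =>
        x j ^ ((i : ℕ) + 2) + if i = Fin.last n ∧ j = 0 then K else 0).submatrix
          i.succAbove Fin.succ) =
      (Matrix.of fun i j : Fin (n + 1) => x j ^ ((i : ℕ) + 2)).submatrix
          i.succAbove Fin.succ := by
    ext a b
    simp
  have hlast : (Matrix.of fun i j : Fin (n + 1) => x j ^ ((i : ℕ) + 2)).submatrix
      (Fin.last n).succAbove Fin.succ =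
      Matrix.of fun i j : Fin n => x j.succ ^ ((i : ℕ) + 2) := by
    ext a b
    simp
  rw [Matrix.det_succ_column_zero]
  simp only [hsub]
  simp only [Matrix.of_apply, and_true, mul_add, add_mul, Finset.sum_add_distrib,
    mul_ite, ite_mul, mul_zero, zero_mul, Finset.sum_ite_eq',
    Finset.mem_univ, if_true, hlast, hminor, Fin.val_last] at hfull ⊢
  rw [hfull]
  ring

/-- Equation (B3) of the paper (with the exponent `p-1` correcting the misprinted
`a₁^(p+1)`): determinant of the matrix `A''` obtained from the coefficient matrix `A'`
of the composed-BDF system (34) by replacing its last column by the right-hand side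
`(0, -E₀, 0, …, 0)ᵀ`. Here `F 0 = E₀ = 1 - a₁` and `F j = E_j = 1 + ρ_j` for
`1 ≤ j ≤ p`. -/
theorem composed_bdf_cramer_det (p : ℕ) (hp : 1 ≤ p) (ρ : ℕ → ℝ)
    (hρ1 : ρ 1 = 0) (hρmono : ∀ j : ℕ, 1 ≤ j → j < p → ρ j < ρ (j + 1))
    (a1 : ℂ) (ha0 : a1 ≠ 0) (ha1 : a1 ≠ 1)
    (hden : ∀ j ∈ Icc 1 p, a1 + (ρ j : ℂ) ≠ 0)
    (ε F : ℕ → ℂ) (γ0 : ℂ)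
    (hε : ∀ j ∈ Icc 1 p, ε j = 1 + (ρ j : ℂ) / a1)
    (hF0 : F 0 = 1 - a1)
    (hF : ∀ j ∈ Icc 1 p, F j = 1 + (ρ j : ℂ))
    (hγ0 : γ0 = ∑ j ∈ Icc 1 p, (ε j)⁻¹)
    (hγ0ne : γ0 ≠ 0) (hcrit : F 0 * γ0 - a1 ≠ 0)
    (A'' : Matrix (Fin (p + 2)) (Fin (p + 2)) ℂ)
    (hA'' : ∀ r c : Fin (p + 2),
      A'' r c =
        if (c : ℕ) = p + 1 then (if (r : ℕ) = 1 then -(F 0) else 0)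
        else if (r : ℕ) = 0 then 1
        else if (c : ℕ) = 0 then 0
        else if (r : ℕ) ≤ p then F ((c : ℕ) - 1) ^ (r : ℕ)
        else if (c : ℕ) = 1 then
          F 0 ^ (p + 1) + (-a1) ^ (p + 1) * (∏ i ∈ Icc 1 p, ε i) / γ0
        else F ((c : ℕ) - 1) ^ (p + 1)) :
    A''.det = (-1) ^ (p + 1) * a1 ^ (p - 1) * F 0 / γ0 *
        (∏ i ∈ Icc 1 (p - 1), ε i * F i ^ 2) *
        (∏ i ∈ Icc 1 (p - 1), ∏ l ∈ Icc 1 (p - 1), (if i < l then F l - F i else 1)) *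
        (γ0 * F 0 ^ 2 + a1 ^ 2 * ε p) := by
  obtain ⟨q, rfl⟩ : ∃ q, p = q + 1 := ⟨p - 1, by omega⟩
  set K := (-a1) ^ (q + 1 + 1) * (∏ i ∈ Icc 1 (q + 1), ε i) / γ0 with hK
  have hfirst : A''.det = (A''.submatrix Fin.succ Fin.succ).det := by
    rw [Matrix.det_succ_column_zero, Fin.sum_univ_succ, Finset.sum_eq_zero]
    · simp [hA'', Fin.succAbove_zero]
    · intro i _
      simp [hA'']
  have hlast : (A''.submatrix Fin.succ Fin.succ).det =
      (-1) ^ q * F 0 * (Matrix.of fun i j : Fin (q + 1) =>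
        F j ^ ((i : ℕ) + 2) + if i = Fin.last q ∧ j = 0 then K else 0).det := by
    rw [Matrix.det_succ_column _ (Fin.last (q + 1)), Fin.sum_univ_succ, Finset.sum_eq_zero]
    · have hsub : (A''.submatrix Fin.succ Fin.succ).submatrix (Fin.succAbove 0)
          (Fin.last (q + 1)).succAbove = Matrix.of fun i j : Fin (q + 1) =>
            F j ^ ((i : ℕ) + 2) + if i = Fin.last q ∧ j = 0 then K else 0 := by
        ext i j
        have hi := i.isLt
        have hj := j.isLt
        simp only [Matrix.submatrix_apply, Matrix.of_apply, hA'', Fin.succAbove_zero,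
          Fin.succAbove_last, Fin.val_succ, Fin.val_castSucc, Fin.ext_iff, Fin.val_last,
          Fin.val_zero, add_tsub_cancel_right]
        rcases eq_or_ne (i : ℕ) q with h | h
        · rcases eq_or_ne (j : ℕ) 0 with h' | h'
          · simp [h, h']
          · simp [h, h', hj.ne]
        · have : (i : ℕ) + 1 + 1 ≤ q + 1 := by omega
          simp [h, hj.ne, this]
      rw [hsub]
      simp [hA'', pow_succ]
    · intro i _
      simp [hA'']
  have hdiff (i : Fin q) : F (i.succ : Fin (q + 1)) - F (0 : Fin (q + 1)) = a1 * ε (i + 1) := by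
    have hi : (i : ℕ) + 1 ∈ Icc 1 (q + 1) := by simp [i.isLt.le]
    simp only [Fin.val_succ, Fin.val_zero]
    rw [hF _ hi, hF0, hε _ hi]
    field_simp
    ring
  have hvand : (∏ i ∈ Icc 1 q, ∏ l ∈ Icc 1 q, (if i < l then F l - F i else 1)) =
      (Matrix.vandermonde fun i : Fin q => F (i + 1)).det := by
    simp only [prod_Icc_one_eq_prod_fin, Matrix.det_vandermonde]
    refine Finset.prod_congr rfl fun i _ => ?_
    rw [← Finset.prod_filter]
    refine Finset.prod_congr ?_ fun _ _ => rfl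
    ext j
    simp
  have hKsplit : K = (-a1) ^ (q + 2) * ((∏ i : Fin q, ε (i + 1)) * ε (q + 1)) / γ0 := by
    rw [hK, Finset.prod_Icc_succ_top (by omega), prod_Icc_one_eq_prod_fin]
  have hsign : ((-1 : ℂ) ^ q) * (-a1) ^ (q + 2) = a1 ^ (q + 2) := by
    rw [neg_pow a1, ← mul_assoc, ← pow_add, Even.neg_one_pow ⟨q + 1, by ring⟩, one_mul]
  rw [hfirst, hlast, det_pow_add_two_add_corner (fun j : Fin (q + 1) => F j)]
  rw [add_tsub_cancel_right, hvand]
  simp only [hdiff, prod_Icc_one_eq_prod_fin _ q,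
    Finset.prod_mul_distrib, Finset.prod_const, Finset.card_univ, Fintype.card_fin]
  have hKsign : (-1) ^ q * K =
      a1 ^ (q + 2) * ((∏ i : Fin q, ε (i + 1)) * ε (q + 1)) / γ0 := by
    rw [hKsplit, ← hsign]
    ring
  rw [hKsign]
  simp only [Fin.val_succ, Fin.val_zero]
  field_simp
  ring
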